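/- Let d ≥ 3 be an integer, D ≥ 1 a real number, and 1 < s ≤ 2. Then |{(j,k) ∈ ℕ² : j < k and |k^d − j^d − D^s| < D}| is bounded by C_d D^{1 + s(2/d − 1)} if 1 < s ≤ d²/(d² − d − 1), and by C_d D^{(s/d)(1 − 1/d)} if d²/(d² − d − 1) ≤ s ≤ 2, for a constant C_d depending only on d. -/

import Mathlib

lemma spread_card {α : Type*} (A : Finset α) (f : α → ℤ) (c : ℝ) (hc : 0 ≤ c)
    (hinj : ∀ a ∈ A, ∀ b ∈ A, f a = f b → a = b)
    (h : ∀ a ∈ A, ∀ b ∈ A, (f b : ℝ) - f a ≤ c) : (A.card : ℝ) ≤ c + 1 := by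
  rcases A.eq_empty_or_nonempty with rfl | hne
  · simp; linarith
  obtain ⟨m, hm, hmin⟩ := Finset.exists_min_image A f hne
  obtain ⟨M, hM, hmax⟩ := Finset.exists_max_image A f hne
  have h1 : A.card ≤ (Finset.Icc (f m) (f M)).card := by
    apply Finset.card_le_card_of_injOn f
    · intro a ha
      simp only [Finset.coe_Icc, Set.mem_Icc]
      exact ⟨hmin a ha, hmax a ha⟩
    · intro a ha b hb hab
      exact hinj a ha b hb hab
  rw [Int.card_Icc] at h1
  have h2 : (A.card : ℤ) ≤ f M + 1 - f m := by
    have := hmin M hM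
    omega
  have h3 : (A.card : ℝ) ≤ f M + 1 - f m := by exact_mod_cast h2
  have := h m hm M hM
  linarith

lemma core_count (T : Finset (ℕ × ℤ)) (L : ℕ) (hL : 1 ≤ L) (X M B K : ℝ)
    (hM : 0 ≤ M) (hB : 0 ≤ B) (hK0 : 0 ≤ K)
    (hx : ∀ P ∈ T, X ≤ (P.1 : ℝ) ∧ (P.1 : ℝ) ≤ X + M)
    (hinj : ∀ P ∈ T, ∀ Q ∈ T, P.1 = Q.1 → P = Q)
    (hy : ∀ P ∈ T, ∀ Q ∈ T, P.1 < Q.1 →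
      1 ≤ Q.2 - P.2 ∧ ((Q.2 : ℝ) - P.2) ≤ B * ((Q.1 : ℝ) - P.1))
    (hK : ∀ P ∈ T, ∀ Q ∈ T, ∀ P' ∈ T, ∀ Q' ∈ T, P.1 < Q.1 → P.1 ≤ P'.1 →
      (Q.1 : ℤ) - P.1 = Q'.1 - P'.1 → Q.2 - P.2 = Q'.2 - P'.2 →
      ((P'.1 : ℝ) - P.1) * ((Q.1 : ℝ) - P.1) ≤ K) :
    (T.card : ℝ) ≤ M / L + 2 + B * K + 2 * B * (L : ℝ) ^ 2 := by
  classical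
  have hL0 : (0 : ℝ) < L := by exact_mod_cast hL
  have divle : ∀ x : ℕ, ((x / L : ℕ) : ℝ) ≤ (x : ℝ) / L := fun x => Nat.cast_div_le
  have divge : ∀ x : ℕ, (x : ℝ) / L - 1 ≤ ((x / L : ℕ) : ℝ) := by
    intro x
    have := Nat.lt_div_mul_add (a := x) (b := L) hL
    have h2 : (x : ℝ) < (x / L : ℕ) * L + L := by exact_mod_cast this
    rw [sub_le_iff_le_add, div_le_iff₀ hL0]
    linarith
  set W := T.image (fun P => P.1 / L) with hW
  have hrep : ∀ w : ℕ, ∃ r : ℕ × ℤ, w ∈ W →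
      (r ∈ T ∧ r.1 / L = w ∧ ∀ Q ∈ T, Q.1 / L = w → r.1 ≤ Q.1) := by
    intro w
    by_cases hw : w ∈ W
    · have hne : (T.filter (fun P => P.1 / L = w)).Nonempty := by
        obtain ⟨P, hP, hPw⟩ := Finset.mem_image.1 hw
        exact ⟨P, Finset.mem_filter.2 ⟨hP, hPw⟩⟩
      obtain ⟨r, hr, hmin⟩ := Finset.exists_min_image _ (fun P : ℕ × ℤ => P.1) hne
      rw [Finset.mem_filter] at hr
      exact ⟨r, fun _ => ⟨hr.1, hr.2, fun Q hQ hQw => hmin Q (Finset.mem_filter.2 ⟨hQ, hQw⟩)⟩⟩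
    · exact ⟨(0, 0), fun h => absurd h hw⟩
  choose rep hrep using hrep
  have memW : ∀ Q ∈ T, Q.1 / L ∈ W := fun Q hQ => Finset.mem_image_of_mem _ hQ
  have hWcard : (W.card : ℝ) ≤ M / L + 2 := by
    have := spread_card W (fun w => (w : ℤ)) (M / L + 1) (by positivity)
      (by intro a _ b _ h; exact_mod_cast h) (by
        intro a ha b hb
        obtain ⟨P, hP, rfl⟩ := Finset.mem_image.1 ha
        obtain ⟨Q, hQ, rfl⟩ := Finset.mem_image.1 hb
        have h1 := divge P.1
        have h2 := divle Q.1
        have h3 : (Q.1 : ℝ) / L - P.1 / L ≤ M / L := by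
          rw [← sub_div]
          apply div_le_div_of_nonneg_right _ hL0.le
          linarith [(hx P hP).1, (hx Q hQ).2]
        simp only [Int.cast_natCast]
        linarith)
    linarith
  set T0 := T.filter (fun Q => Q = rep (Q.1 / L)) with hT0
  set T1 := T.filter (fun Q => ¬ Q = rep (Q.1 / L)) with hT1
  have hsplit : T0.card + T1.card = T.card := Finset.card_filter_add_card_filter_not _
  have hT0card : T0.card ≤ W.card := by
    apply Finset.card_le_card_of_injOn (fun Q => Q.1 / L)
    · intro Q hQ
      exact memW Q (Finset.mem_filter.1 hQ).1
    · intro P hP Q hQ h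
      have h1 := (Finset.mem_filter.1 hP).2
      have h2 := (Finset.mem_filter.1 hQ).2
      simp only at h
      rw [h1, h2, h]
  have key : ∀ Q ∈ T1, Q ∈ T ∧ rep (Q.1 / L) ∈ T ∧ (rep (Q.1 / L)).1 / L = Q.1 / L ∧
      (rep (Q.1 / L)).1 < Q.1 := by
    intro Q hQ
    obtain ⟨hQT, hne⟩ := Finset.mem_filter.1 hQ
    obtain ⟨h1, h2, h3⟩ := hrep _ (memW Q hQT)
    refine ⟨hQT, h1, h2, lt_of_le_of_ne (h3 Q hQT rfl) ?_⟩
    intro h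
    exact hne (hinj _ h1 _ hQT h).symm
  let e : ℕ × ℤ → (_ : ℕ) × ℕ := fun Q =>
    ⟨Q.1 - (rep (Q.1 / L)).1, (Q.2 - (rep (Q.1 / L)).2).toNat⟩
  let V : Finset ((_ : ℕ) × ℕ) := (Finset.Ico 1 L).sigma (fun U => Finset.Icc 1 ⌊B * U⌋₊)
  have hmaps : ∀ Q ∈ T1, e Q ∈ V := by
    intro Q hQ
    obtain ⟨hQT, hr, hw, hlt⟩ := key Q hQ
    obtain ⟨hy1, hy2⟩ := hy _ hr _ hQT hlt
    simp only [V, e, Finset.mem_sigma, Finset.mem_Ico, Finset.mem_Icc]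
    refine ⟨⟨by omega, ?_⟩, by omega, ?_⟩
    · have h1 := Nat.div_add_mod Q.1 L
      have h2 := Nat.div_add_mod (rep (Q.1 / L)).1 L
      have h3 := Nat.mod_lt Q.1 (show L > 0 by omega)
      rw [hw] at h2
      omega
    · apply Nat.le_floor
      rw [Nat.cast_sub hlt.le]
      have : (((Q.2 - (rep (Q.1 / L)).2).toNat : ℕ) : ℝ) = (Q.2 : ℝ) - (rep (Q.1 / L)).2 := by
        have : (((Q.2 - (rep (Q.1 / L)).2).toNat : ℕ) : ℤ) = Q.2 - (rep (Q.1 / L)).2 :=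
          Int.toNat_of_nonneg (by omega)
        exact_mod_cast congrArg (fun z : ℤ => (z : ℝ)) this
      rw [this]
      exact hy2
  have hfib : ∀ v ∈ V, (((T1.filter (fun Q => e Q = v)).card : ℕ) : ℝ) ≤ K / (v.1 * L) + 2 := by
    rintro ⟨U, Wv⟩ hv
    simp only [V, Finset.mem_sigma, Finset.mem_Ico, Finset.mem_Icc] at hv
    obtain ⟨⟨hU1, hU2⟩, hW1, hW2⟩ := hv
    have hU0 : (0 : ℝ) < U := by exact_mod_cast hU1
    have hinfo : ∀ Q ∈ T1.filter (fun Q => e Q = ⟨U, Wv⟩), Q ∈ T1 ∧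
        Q.1 = (rep (Q.1 / L)).1 + U ∧ Q.2 = (rep (Q.1 / L)).2 + Wv := by
      intro Q hQ
      obtain ⟨hQ1, hQ2⟩ := Finset.mem_filter.1 hQ
      obtain ⟨hQT, hr, hw, hlt⟩ := key Q hQ1
      obtain ⟨hy1, hy2⟩ := hy _ hr _ hQT hlt
      simp only [e, Sigma.mk.injEq, heq_eq_eq] at hQ2
      exact ⟨hQ1, by omega, by omega⟩
    have := spread_card (T1.filter (fun Q => e Q = ⟨U, Wv⟩)) (fun Q => ((Q.1 / L : ℕ) : ℤ))
      (K / (U * L) + 1) (by positivity) (by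
        intro P hP Q hQ h
        obtain ⟨hP1, hP2, hP3⟩ := hinfo P hP
        obtain ⟨hQ1, hQ2, hQ3⟩ := hinfo Q hQ
        have h' : P.1 / L = Q.1 / L := by exact_mod_cast h
        rw [h'] at hP2 hP3
        exact Prod.ext (by omega) (by omega)) (by
        intro P hP Q hQ
        obtain ⟨hP1, hP2, hP3⟩ := hinfo P hP
        obtain ⟨hQ1, hQ2, hQ3⟩ := hinfo Q hQ
        obtain ⟨hPT, hPr, hPw, hPlt⟩ := key P hP1
        obtain ⟨hQT, hQr, hQw, hQlt⟩ := key Q hQ1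
        set p := rep (P.1 / L)
        set q := rep (Q.1 / L)
        have hnn : 0 ≤ K / (U * L) := by positivity
        by_cases hle : p.1 ≤ q.1
        · have hk := hK p hPr P hPT q hQr Q hQT hPlt hle (by omega) (by omega)
          have hUU : (P.1 : ℝ) - p.1 = U := by rw [hP2]; push_cast; ring
          rw [hUU] at hk
          have h1 := divge p.1
          have h2 := divle q.1
          rw [hPw] at h1
          rw [hQw] at h2
          have h3 : (q.1 : ℝ) / L - p.1 / L ≤ K / (U * L) := by
            rw [← sub_div, ← div_div]
            apply div_le_div_of_nonneg_right _ hL0.le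
            rw [le_div_iff₀ hU0]
            exact hk
          simp only [Int.cast_natCast]
          linarith
        · have : Q.1 / L ≤ P.1 / L := by
            rw [← hPw, ← hQw]
            exact Nat.div_le_div_right (by omega)
          have : ((Q.1 / L : ℕ) : ℝ) ≤ (P.1 / L : ℕ) := by exact_mod_cast this
          simp only [Int.cast_natCast]
          linarith)
    simp only
    linarith
  have hT1card : (T1.card : ℝ) ≤ B * K + 2 * B * (L : ℝ) ^ 2 := by
    rw [Finset.card_eq_sum_card_fiberwise hmaps]
    push_cast
    calc ∑ v ∈ V, ((T1.filter (fun Q => e Q = v)).card : ℝ)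
        ≤ ∑ v ∈ V, (K / (v.1 * L) + 2) := Finset.sum_le_sum hfib
      _ = ∑ U ∈ Finset.Ico 1 L, ∑ _w ∈ Finset.Icc 1 ⌊B * (U : ℝ)⌋₊, (K / ((U : ℝ) * L) + 2) := by
          rw [Finset.sum_sigma]
      _ ≤ ∑ U ∈ Finset.Ico 1 L, (B * K / L + 2 * B * L) := by
          apply Finset.sum_le_sum
          intro U hU
          rw [Finset.mem_Ico] at hU
          have hU0 : (0 : ℝ) < U := by exact_mod_cast hU.1
          have hUL : (U : ℝ) ≤ L := by exact_mod_cast hU.2.le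
          rw [Finset.sum_const, Nat.card_Icc, nsmul_eq_mul, Nat.add_sub_cancel]
          calc (⌊B * (U : ℝ)⌋₊ : ℝ) * (K / (U * L) + 2) ≤ (B * U) * (K / (U * L) + 2) := by
                apply mul_le_mul_of_nonneg_right (Nat.floor_le (by positivity)) (by positivity)
            _ = B * K / L + 2 * B * U := by field_simp
            _ ≤ _ := by gcongr
      _ = ((L - 1 : ℕ) : ℝ) * (B * K / L + 2 * B * L) := by
          rw [Finset.sum_const, Nat.card_Ico, nsmul_eq_mul]
      _ ≤ L * (B * K / L + 2 * B * L) := by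
          apply mul_le_mul_of_nonneg_right _ (by positivity)
          exact_mod_cast Nat.sub_le L 1
      _ = _ := by field_simp
  have h1 : (T.card : ℝ) = T0.card + T1.card := by exact_mod_cast hsplit.symm
  have h2 : (T0.card : ℝ) ≤ W.card := by exact_mod_cast hT0card
  linarith

lemma block_count (S : Finset (ℕ × ℤ)) (h : ℝ → ℝ) (L : ℕ) (hL : 1 ≤ L) (X M b B lam δ : ℝ)
    (hM : 0 ≤ M) (hb : 0 < b) (hB : 0 ≤ B) (hlam : 0 < lam) (hδ0 : 0 ≤ δ) (hδ : δ ≤ 1 / 4)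
    (hx : ∀ P ∈ S, X ≤ (P.1 : ℝ) ∧ (P.1 : ℝ) ≤ X + M)
    (hclose : ∀ P ∈ S, |(P.2 : ℝ) - h P.1| ≤ δ)
    (hinc : ∀ x y, X ≤ x → x ≤ y → y ≤ X + M → b * (y - x) ≤ h y - h x ∧ h y - h x ≤ B * (y - x))
    (hsec : ∀ x y U, X ≤ x → x ≤ y → 0 ≤ U → y + U ≤ X + M →
      lam * U * (y - x) ≤ |(h (y + U) - h y) - (h (x + U) - h x)|) :
    (S.card : ℝ) ≤ (M / L + 2 + 2 * B * (4 * δ / lam) + 4 * B * (L : ℝ) ^ 2)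
      + (2 * B * M + 1) * (2 * δ / b) := by
  classical
  set Y := S.image Prod.snd with hY
  have hg : ∀ y : ℤ, ∃ P : ℕ × ℤ, y ∈ Y → P ∈ S ∧ P.2 = y := by
    intro y
    by_cases hy : y ∈ Y
    · obtain ⟨P, hP, hPy⟩ := Finset.mem_image.1 hy
      exact ⟨P, fun _ => ⟨hP, hPy⟩⟩
    · exact ⟨(0, 0), fun h => absurd h hy⟩
  choose g hg using hg
  set T := Y.image g with hT
  have hTS : ∀ P ∈ T, P ∈ S := by
    intro P hP
    obtain ⟨y, hy, rfl⟩ := Finset.mem_image.1 hP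
    exact (hg y hy).1
  have hTinj : ∀ P ∈ T, ∀ Q ∈ T, P.2 = Q.2 → P = Q := by
    intro P hP Q hQ h
    obtain ⟨y, hy, rfl⟩ := Finset.mem_image.1 hP
    obtain ⟨z, hz, rfl⟩ := Finset.mem_image.1 hQ
    rw [(hg y hy).2, (hg z hz).2] at h
    rw [h]
  have hTcard : T.card = Y.card := by
    apply Finset.card_image_of_injOn
    intro y hy z hz hyz
    have := congrArg Prod.snd hyz
    rwa [(hg y hy).2, (hg z hz).2] at this
  have hdiff : ∀ P ∈ S, ∀ Q ∈ S, |((Q.2 : ℝ) - P.2) - (h Q.1 - h P.1)| ≤ 2 * δ := by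
    intro P hP Q hQ
    have h1 := abs_le.1 (hclose P hP)
    have h2 := abs_le.1 (hclose Q hQ)
    rw [abs_le]
    constructor <;> linarith [h1.1, h1.2, h2.1, h2.2]
  have hxinj : ∀ P ∈ S, ∀ Q ∈ S, P.1 = Q.1 → P = Q := by
    intro P hP Q hQ hPQ
    have h1 := abs_le.1 (hdiff P hP Q hQ)
    rw [hPQ, sub_self] at h1
    have h2 : ((Q.2 - P.2 : ℤ) : ℝ) < 1 := by push_cast; linarith [h1.2]
    have h3 : (-1 : ℝ) < ((Q.2 - P.2 : ℤ) : ℝ) := by push_cast; linarith [h1.1]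
    have h2' : Q.2 - P.2 < 1 := by exact_mod_cast h2
    have h3' : -1 < Q.2 - P.2 := by exact_mod_cast h3
    exact Prod.ext hPQ (by omega)
  have hTy : ∀ P ∈ T, ∀ Q ∈ T, P.1 < Q.1 →
      1 ≤ Q.2 - P.2 ∧ ((Q.2 : ℝ) - P.2) ≤ (2 * B) * ((Q.1 : ℝ) - P.1) := by
    intro P hP Q hQ hlt
    have hlt' : (P.1 : ℝ) < Q.1 := by exact_mod_cast hlt
    have h1 := abs_le.1 (hdiff P (hTS P hP) Q (hTS Q hQ))
    obtain ⟨h2, h3⟩ := hinc P.1 Q.1 (hx P (hTS P hP)).1 hlt'.le (hx Q (hTS Q hQ)).2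
    have h4 : 0 < b * ((Q.1 : ℝ) - P.1) := mul_pos hb (by linarith)
    have h5 : (-1 : ℝ) < ((Q.2 - P.2 : ℤ) : ℝ) := by push_cast; linarith [h1.1]
    have h5' : -1 < Q.2 - P.2 := by exact_mod_cast h5
    have h6 : Q.2 - P.2 ≠ 0 := by
      intro h0
      have := hTinj P hP Q hQ (by omega)
      rw [this] at hlt
      exact lt_irrefl _ hlt
    have h7 : 1 ≤ Q.2 - P.2 := by omega
    have h8 : (1 : ℝ) ≤ (Q.2 : ℝ) - P.2 := by exact_mod_cast h7
    exact ⟨h7, by linarith [h1.2]⟩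
  have hmain := core_count T L hL X M (2 * B) (4 * δ / lam) hM (by positivity) (by positivity)
    (fun P hP => hx P (hTS P hP)) (fun P hP Q hQ => hxinj P (hTS P hP) Q (hTS Q hQ)) hTy (by
      intro P hP Q hQ P' hP' Q' hQ' hlt hle hU hV
      have hlt' : (P.1 : ℝ) < Q.1 := by exact_mod_cast hlt
      have hle' : (P.1 : ℝ) ≤ P'.1 := by exact_mod_cast hle
      have hU' : (Q.1 : ℝ) - P.1 = Q'.1 - P'.1 := by exact_mod_cast hU
      have hV' : (Q.2 : ℝ) - P.2 = Q'.2 - P'.2 := by exact_mod_cast hV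
      have e1 : (P'.1 : ℝ) + (Q.1 - P.1) = Q'.1 := by linarith
      have e2 : (P.1 : ℝ) + (Q.1 - P.1) = Q.1 := by linarith
      have h1 := hsec P.1 P'.1 (Q.1 - P.1) (hx P (hTS P hP)).1 hle' (by linarith)
        (by rw [e1]; exact (hx Q' (hTS Q' hQ')).2)
      rw [e1, e2] at h1
      have h2 := abs_le.1 (hdiff P (hTS P hP) Q (hTS Q hQ))
      have h3 := abs_le.1 (hdiff P' (hTS P' hP') Q' (hTS Q' hQ'))
      have h4 : |(h Q'.1 - h P'.1) - (h Q.1 - h P.1)| ≤ 4 * δ := by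
        rw [abs_le]
        constructor <;> linarith [h2.1, h2.2, h3.1, h3.2]
      rw [le_div_iff₀ hlam]
      calc _ = lam * ((Q.1 : ℝ) - P.1) * (P'.1 - P.1) := by ring
        _ ≤ _ := h1.trans h4)
  have hYc : (T.card : ℝ) ≤ 2 * B * M + 1 := by
    apply spread_card T (fun P => P.2) (2 * B * M) (by positivity) hTinj
    intro P hP Q hQ
    rcases lt_trichotomy P.1 Q.1 with hlt | heq | hgt
    · refine (hTy P hP Q hQ hlt).2.trans ?_
      apply mul_le_mul_of_nonneg_left _ (by positivity)
      linarith [(hx P (hTS P hP)).1, (hx Q (hTS Q hQ)).2]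
    · rw [hxinj P (hTS P hP) Q (hTS Q hQ) heq]
      simp only [sub_self]; positivity
    · have := (hTy Q hQ P hP hgt).1
      have : (1 : ℝ) ≤ (P.2 : ℝ) - Q.2 := by exact_mod_cast this
      have : 0 ≤ 2 * B * M := by positivity
      linarith
  have hScard : (S.card : ℝ) ≤ Y.card * (2 * δ / b + 1) := by
    rw [Finset.card_eq_sum_card_image Prod.snd S, ← nsmul_eq_mul, ← Finset.sum_const]
    push_cast
    apply Finset.sum_le_sum
    intro y hy
    apply spread_card _ (fun P => (P.1 : ℤ)) (2 * δ / b) (by positivity)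
    · intro P hP Q hQ hPQ
      exact hxinj P (Finset.mem_filter.1 hP).1 Q (Finset.mem_filter.1 hQ).1 (by exact_mod_cast hPQ)
    · intro P hP Q hQ
      obtain ⟨hP1, hP2⟩ := Finset.mem_filter.1 hP
      obtain ⟨hQ1, hQ2⟩ := Finset.mem_filter.1 hQ
      simp only [Int.cast_natCast]
      by_cases hle : (P.1 : ℝ) ≤ Q.1
      · have h1 := abs_le.1 (hdiff P hP1 Q hQ1)
        rw [hP2, hQ2, sub_self] at h1
        have h2 := (hinc P.1 Q.1 (hx P hP1).1 hle (hx Q hQ1).2).1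
        rw [le_div_iff₀ hb]
        linarith [h1.1]
      · have : 0 ≤ 2 * δ / b := by positivity
        linarith
  rw [← hTcard] at hScard
  have h9 : (T.card : ℝ) * (2 * δ / b) ≤ (2 * B * M + 1) * (2 * δ / b) :=
    mul_le_mul_of_nonneg_right hYc (by positivity)
  linarith

/-- The level curve `k = (N^d + x^d)^(1/d)` with `d = e + 2`. -/
noncomputable def shellF (N : ℝ) (e : ℕ) (x : ℝ) : ℝ :=
  (N ^ (e + 2) + x ^ (e + 2)) ^ (1 / ((e + 2 : ℕ) : ℝ))

lemma shellF_nonneg (N : ℝ) (e : ℕ) (x : ℝ) (hN : 0 < N) (hx : 0 ≤ x) : 0 ≤ shellF N e x :=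
  Real.rpow_nonneg (by positivity) _

lemma shellF_pow (N : ℝ) (e : ℕ) (x : ℝ) (hN : 0 < N) (hx : 0 ≤ x) :
    shellF N e x ^ (e + 2) = N ^ (e + 2) + x ^ (e + 2) := by
  unfold shellF
  rw [one_div, Real.rpow_inv_natCast_pow (by positivity) (by omega)]

lemma shellF_ge_N (N : ℝ) (e : ℕ) (x : ℝ) (hN : 0 < N) (hx : 0 ≤ x) : N ≤ shellF N e x := by
  apply le_of_pow_le_pow_left₀ (n := e + 2) (by omega) (shellF_nonneg N e x hN hx)
  rw [shellF_pow N e x hN hx]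
  have : 0 ≤ x ^ (e + 2) := by positivity
  linarith

lemma shellF_ge_x (N : ℝ) (e : ℕ) (x : ℝ) (hN : 0 < N) (hx : 0 ≤ x) : x ≤ shellF N e x := by
  apply le_of_pow_le_pow_left₀ (n := e + 2) (by omega) (shellF_nonneg N e x hN hx)
  rw [shellF_pow N e x hN hx]
  have : 0 ≤ N ^ (e + 2) := by positivity
  linarith

lemma shellF_le (N : ℝ) (e : ℕ) (x Y : ℝ) (hN : 0 < N) (hx : 0 ≤ x) (hNY : N ≤ Y)
    (hxY : x ≤ 8 * Y) : shellF N e x ≤ 9 * Y := by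
  apply le_of_pow_le_pow_left₀ (n := e + 2) (by omega) (by linarith)
  rw [shellF_pow N e x hN hx]
  calc N ^ (e + 2) + x ^ (e + 2) ≤ Y ^ (e + 2) + (8 * Y) ^ (e + 2) := by gcongr
    _ ≤ (Y + 8 * Y) ^ (e + 2) := by
        apply pow_add_pow_le _ _ (by omega) <;> linarith
    _ = _ := by congr 1; ring

lemma shellF_hasDeriv (N : ℝ) (e : ℕ) (x : ℝ) (hN : 0 < N) (hx : 0 < x) :
    HasDerivAt (shellF N e) ((x / shellF N e x) ^ (e + 1)) x := by
  have hbase : 0 < N ^ (e + 2) + x ^ (e + 2) := by positivity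
  have h1 : HasDerivAt (fun y : ℝ => N ^ (e + 2) + y ^ (e + 2)) (((e + 2 : ℕ) : ℝ) * x ^ (e + 1)) x := by
    have := (hasDerivAt_pow (e + 2) x).const_add (N ^ (e + 2))
    simpa using this
  have h2 := h1.rpow_const (p := 1 / ((e + 2 : ℕ) : ℝ)) (Or.inl hbase.ne')
  have hF := shellF_pow N e x hN hx.le
  have hF0 : 0 < shellF N e x := hN.trans_le (shellF_ge_N N e x hN hx.le)
  change HasDerivAt (shellF N e) _ x at h2
  convert h2 using 1
  rw [Real.rpow_sub_one hbase.ne']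
  change _ = ((e + 2 : ℕ) : ℝ) * x ^ (e + 1) * (1 / ((e + 2 : ℕ) : ℝ)) *
    (shellF N e x / (N ^ (e + 2) + x ^ (e + 2)))
  rw [← hF, div_pow]
  have : ((e + 2 : ℕ) : ℝ) ≠ 0 := by positivity
  field_simp
  ring

lemma shellU_hasDeriv (N : ℝ) (e : ℕ) (x : ℝ) (hN : 0 < N) (hx : 0 < x) :
    HasDerivAt (fun y => (y / shellF N e y) ^ (e + 1))
      ((e + 1) * (x / shellF N e x) ^ e * (N ^ (e + 2) / shellF N e x ^ (e + 3))) x := by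
  have hF := shellF_pow N e x hN hx.le
  have hF0 : 0 < shellF N e x := hN.trans_le (shellF_ge_N N e x hN hx.le)
  have h1 := ((hasDerivAt_id x).div (shellF_hasDeriv N e x hN hx) hF0.ne').pow (e + 1)
  change HasDerivAt (fun y => (y / shellF N e y) ^ (e + 1)) _ x at h1
  convert h1 using 1
  simp only [Pi.div_apply, id, Nat.add_sub_cancel]
  have hN' : N ^ (e + 2) = shellF N e x ^ (e + 2) - x ^ (e + 2) := by linarith
  rw [hN']
  push_cast
  congr 1
  set F := shellF N e x
  rw [div_pow]
  field_simp
  ring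

lemma shell_sec (N : ℝ) (e : ℕ) (X Y : ℝ) (hN : 0 < N) (hX : 0 < X) (hNY : N ≤ Y)
    (hXY : X ≤ Y) :
    ∀ x y U, X ≤ x → x ≤ y → 0 ≤ U → y + U ≤ 8 * X →
      (X / (9 * Y)) ^ e * (N ^ (e + 2) / (9 * Y) ^ (e + 3)) * U * (y - x) ≤
      (shellF N e (y + U) - shellF N e y) - (shellF N e (x + U) - shellF N e x) := by
  intro x y U hx hxy hU hyU
  have hY : 0 < Y := hN.trans_le hNY
  set lam := (X / (9 * Y)) ^ e * (N ^ (e + 2) / (9 * Y) ^ (e + 3)) with hlam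
  -- derivative increments
  have hd1 : ∀ u, 0 ≤ u → u ≤ U → lam * (y - x) ≤
      ((y + u) / shellF N e (y + u)) ^ (e + 1) - ((x + u) / shellF N e (x + u)) ^ (e + 1) := by
    intro u hu0 huU
    have := Convex.mul_sub_le_image_sub_of_le_deriv (convex_Icc X (8 * X))
      (f := fun y => (y / shellF N e y) ^ (e + 1)) (C := lam)
      (fun z hz => (shellU_hasDeriv N e z hN (hX.trans_le hz.1)).continuousAt.continuousWithinAt)
      (fun z hz => (shellU_hasDeriv N e z hN
        (hX.trans_le (interior_subset hz).1)).differentiableAt.differentiableWithinAt)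
      (by
        intro z hz
        have hz' := interior_subset hz
        have hz0 : 0 < z := hX.trans_le hz'.1
        rw [(shellU_hasDeriv N e z hN hz0).deriv]
        have hF0 : 0 < shellF N e z := hN.trans_le (shellF_ge_N N e z hN hz0.le)
        have hF9 : shellF N e z ≤ 9 * Y := shellF_le N e z Y hN hz0.le hNY (by linarith [hz'.2])
        have hz1 := hz'.1
        rw [hlam]
        have h1 : (X / (9 * Y)) ^ e ≤ (z / shellF N e z) ^ e := by gcongr
        have h2 : N ^ (e + 2) / (9 * Y) ^ (e + 3) ≤ N ^ (e + 2) / shellF N e z ^ (e + 3) := by gcongr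
        have h3 : (X / (9 * Y)) ^ e * (N ^ (e + 2) / (9 * Y) ^ (e + 3)) ≤
          (z / shellF N e z) ^ e * (N ^ (e + 2) / shellF N e z ^ (e + 3)) := by gcongr
        have h4 : 0 ≤ (z / shellF N e z) ^ e * (N ^ (e + 2) / shellF N e z ^ (e + 3)) := by positivity
        have h5 : (0 : ℝ) ≤ e := by positivity
        nlinarith)
      (x + u) ⟨by linarith, by linarith⟩ (y + u) ⟨by linarith, by linarith⟩ (by linarith)
    have e1 : y + u - (x + u) = y - x := by ring
    rw [e1] at this
    exact this
  have hg : ∀ u, 0 ≤ u → HasDerivAt (fun u => shellF N e (y + u) - shellF N e (x + u))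
      (((y + u) / shellF N e (y + u)) ^ (e + 1) - ((x + u) / shellF N e (x + u)) ^ (e + 1)) u := by
    intro u hu
    exact ((shellF_hasDeriv N e (y + u) hN (by linarith)).comp_const_add y u).sub
      ((shellF_hasDeriv N e (x + u) hN (by linarith)).comp_const_add x u)
  have := Convex.mul_sub_le_image_sub_of_le_deriv (convex_Icc 0 U)
      (f := fun u => shellF N e (y + u) - shellF N e (x + u)) (C := lam * (y - x))
      (fun z hz => (hg z hz.1).continuousAt.continuousWithinAt)
      (fun z hz => (hg z (interior_subset hz).1).differentiableAt.differentiableWithinAt)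
      (by
        intro z hz
        have hz' := interior_subset hz
        rw [(hg z hz'.1).deriv]
        exact hd1 z hz'.1 hz'.2)
      0 ⟨le_rfl, hU⟩ U ⟨hU, le_rfl⟩ hU
  simp only [add_zero, sub_zero] at this
  linarith

lemma inc_bounds (h h' : ℝ → ℝ) (X Z b B : ℝ)
    (hd : ∀ x, X ≤ x → x ≤ Z → HasDerivAt h (h' x) x)
    (hb : ∀ x, X ≤ x → x ≤ Z → b ≤ h' x ∧ h' x ≤ B) :
    ∀ x y, X ≤ x → x ≤ y → y ≤ Z → b * (y - x) ≤ h y - h x ∧ h y - h x ≤ B * (y - x) := by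
  intro x y hx hxy hy
  have hc : ContinuousOn h (Set.Icc X Z) :=
    fun z hz => (hd z hz.1 hz.2).continuousAt.continuousWithinAt
  have hdiff : DifferentiableOn ℝ h (interior (Set.Icc X Z)) := fun z hz =>
    (hd z (interior_subset hz).1 (interior_subset hz).2).differentiableAt.differentiableWithinAt
  constructor
  · exact Convex.mul_sub_le_image_sub_of_le_deriv (convex_Icc X Z) hc hdiff (by
      intro z hz
      have hz' := interior_subset hz
      rw [(hd z hz'.1 hz'.2).deriv]
      exact (hb z hz'.1 hz'.2).1) x ⟨hx, hxy.trans hy⟩ y ⟨hx.trans hxy, hy⟩ hxy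
  · exact Convex.image_sub_le_mul_sub_of_deriv_le (convex_Icc X Z) hc hdiff (by
      intro z hz
      have hz' := interior_subset hz
      rw [(hd z hz'.1 hz'.2).deriv]
      exact (hb z hz'.1 hz'.2).2) x ⟨hx, hxy.trans hy⟩ y ⟨hx.trans hxy, hy⟩ hxy

lemma flat_inc (N : ℝ) (e : ℕ) (X : ℝ) (hN : 0 < N) (hX : 0 < X) (hXN : X ≤ N) :
    ∀ x y, X ≤ x → x ≤ y → y ≤ 8 * X →
      (X / (9 * N)) ^ (e + 1) * (y - x) ≤ shellF N e y - shellF N e x ∧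
      shellF N e y - shellF N e x ≤ (8 * X / N) ^ (e + 1) * (y - x) := by
  apply inc_bounds _ _ _ _ _ _ (fun x hx _ => shellF_hasDeriv N e x hN (hX.trans_le hx))
  intro x hx hx8
  have hx0 : 0 < x := hX.trans_le hx
  have h1 := shellF_ge_N N e x hN hx0.le
  have h2 := shellF_le N e x N hN hx0.le le_rfl (by linarith)
  have h3 : 0 < shellF N e x := by linarith
  constructor <;> gcongr

lemma cusp_inc (N : ℝ) (e : ℕ) (X : ℝ) (hN : 0 < N) (hX : N ≤ X) :
    ∀ x y, X ≤ x → x ≤ y → y ≤ 8 * X →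
      (N / (9 * X)) ^ (e + 2) / (e + 2) * (y - x) ≤ (y - shellF N e y) - (x - shellF N e x) ∧
      (y - shellF N e y) - (x - shellF N e x) ≤ (N / X) ^ (e + 2) * (y - x) := by
  have hX0 : 0 < X := hN.trans_le hX
  apply inc_bounds (fun x => x - shellF N e x) _ _ _ _ _
    (fun x hx _ => (hasDerivAt_id x).sub (shellF_hasDeriv N e x hN (hX0.trans_le hx)))
  intro x hx hx8
  have hx0 : 0 < x := hX0.trans_le hx
  have h1 := shellF_ge_x N e x hN hx0.le
  have h2 := shellF_le N e x X hN hx0.le hX (by linarith)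
  have h3 : 0 < shellF N e x := by linarith
  have hF := shellF_pow N e x hN hx0.le
  set F := shellF N e x
  have hu0 : 0 ≤ x / F := by positivity
  have hu1 : x / F ≤ 1 := by rw [div_le_one h3]; exact h1
  have hud : 1 - (x / F) ^ (e + 2) = (N / F) ^ (e + 2) := by
    rw [div_pow, div_pow]
    field_simp
    linarith
  constructor
  · have hbern : 1 - (x / F) ^ (e + 2) ≤ (e + 2) * (1 - x / F) := by
      have := one_add_mul_le_pow (a := x / F - 1) (by linarith) (e + 2)
      push_cast at this
      have e1 : 1 + (x / F - 1) = x / F := by ring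
      rw [e1] at this
      linarith
    have h5 : (x / F) ^ (e + 1) ≤ x / F := pow_le_of_le_one hu0 hu1 (by omega)
    have h6 : (N / (9 * X)) ^ (e + 2) ≤ (N / F) ^ (e + 2) := by gcongr
    rw [div_le_iff₀ (by positivity)]
    rw [hud] at hbern
    have : (0 : ℝ) < e + 2 := by positivity
    nlinarith
  · have h5 : (x / F) ^ (e + 2) ≤ (x / F) ^ (e + 1) := pow_le_pow_of_le_one hu0 hu1 (by omega)
    have h6 : (N / F) ^ (e + 2) ≤ (N / X) ^ (e + 2) := by
      have : X ≤ F := by linarith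
      gcongr
    linarith

lemma shell_close (N : ℝ) (e : ℕ) (D : ℝ) (x k Y : ℝ) (hN : 0 < N) (hx : 0 ≤ x)
    (hk : 0 ≤ k) (hY : 0 < Y) (hYF : Y ≤ shellF N e x)
    (h : |k ^ (e + 2) - x ^ (e + 2) - N ^ (e + 2)| < D) :
    |k - shellF N e x| ≤ D / Y ^ (e + 1) := by
  have hF := shellF_pow N e x hN hx
  set F := shellF N e x
  have h1 : |k ^ (e + 2) - F ^ (e + 2)| < D := by
    rw [hF]
    convert h using 2
    ring
  have hF0 : 0 < F := hY.trans_le hYF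
  have h2 : |k - F| * F ^ (e + 1) ≤ |k ^ (e + 2) - F ^ (e + 2)| := by
    rcases le_total k F with hle | hle
    · rw [abs_of_nonpos (by linarith), abs_of_nonpos (by linarith [pow_le_pow_left₀ hk hle (e + 2)])]
      have : k ^ (e + 1) ≤ F ^ (e + 1) := pow_le_pow_left₀ hk hle _
      have e1 : F ^ (e + 2) = F * F ^ (e + 1) := by ring
      have e2 : k ^ (e + 2) = k * k ^ (e + 1) := by ring
      rw [e1, e2]
      nlinarith
    · rw [abs_of_nonneg (by linarith),
        abs_of_nonneg (by linarith [pow_le_pow_left₀ hF0.le hle (e + 2)])]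
      have : F ^ (e + 1) ≤ k ^ (e + 1) := pow_le_pow_left₀ hF0.le hle _
      have e1 : F ^ (e + 2) = F * F ^ (e + 1) := by ring
      have e2 : k ^ (e + 2) = k * k ^ (e + 1) := by ring
      rw [e1, e2]
      nlinarith
  have h3 : |k - F| * Y ^ (e + 1) ≤ |k - F| * F ^ (e + 1) := by gcongr
  rw [le_div_iff₀ (by positivity)]
  linarith

lemma floor_half (z : ℝ) (hz : 1 ≤ z) : 1 ≤ ⌊z⌋₊ ∧ (⌊z⌋₊ : ℝ) ≤ z ∧ z / 2 ≤ ⌊z⌋₊ := by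
  have h1 : 1 ≤ ⌊z⌋₊ := Nat.le_floor (by simpa using hz)
  have h2 := Nat.lt_floor_add_one z
  have h3 : (1 : ℝ) ≤ ⌊z⌋₊ := by exact_mod_cast h1
  exact ⟨h1, Nat.floor_le (by linarith), by linarith⟩

lemma flat_block (e : ℕ) (he : 1 ≤ e) : ∃ C : ℝ, 0 < C ∧ ∀ (n δ t : ℝ) (S : Finset (ℕ × ℕ)),
    1 ≤ n → 0 ≤ δ → δ ≤ 1 / 4 → 0 < t → t ≤ 1 → 1 / 8 ≤ t * n ^ 2 →
    1 ≤ 8 ^ (e + 2) * n ^ 3 * t ^ (e + 2) →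
    (∀ P ∈ S, t * n ^ 3 ≤ (P.1 : ℝ) ∧ (P.1 : ℝ) ≤ 8 * (t * n ^ 3) ∧
      |(P.2 : ℝ) ^ (e + 2) - (P.1 : ℝ) ^ (e + 2) - (n ^ 3) ^ (e + 2)| < δ * (n ^ 3) ^ (e + 1)) →
    (S.card : ℝ) ≤ C * (n ^ 2 + n ^ 3 * δ) * t := by
  refine ⟨14 + 16 + 8 * 8 ^ (e + 1) * 9 ^ (2 * e + 3) + 4 * 8 ^ (e + 1)
    + 28 * 72 ^ (e + 1) + 2 * 9 ^ (e + 1) * 8 ^ (e + 2), by positivity, ?_⟩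
  intro n δ t S hn hδ0 hδ ht0 ht1 htn htd hS
  have hn0 : 0 < n := by linarith
  set N := n ^ 3 with hN
  have hN0 : 0 < N := by positivity
  set X := t * N with hX
  have hX0 : 0 < X := by positivity
  have hXN : X ≤ N := by rw [hX]; nlinarith
  obtain ⟨hL1, hLle, hLge⟩ := floor_half n hn
  set L := ⌊n⌋₊
  have hcard : (S.image (fun P : ℕ × ℕ => (P.1, (P.2 : ℤ)))).card = S.card := by
    apply Finset.card_image_of_injective
    rintro ⟨a, b⟩ ⟨c, d⟩ h
    simpa using h
  have h87 : X + 7 * X = 8 * X := by ring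
  have hblk := block_count (S.image (fun P : ℕ × ℕ => (P.1, (P.2 : ℤ)))) (shellF N e) L hL1
    X (7 * X) ((X / (9 * N)) ^ (e + 1)) ((8 * X / N) ^ (e + 1))
    ((X / (9 * N)) ^ e * (N ^ (e + 2) / (9 * N) ^ (e + 3))) δ (by positivity) (by positivity)
    (by positivity) (by positivity) hδ0 hδ
    (by
      intro P hP
      obtain ⟨Q, hQ, rfl⟩ := Finset.mem_image.1 hP
      rw [h87]
      exact ⟨(hS Q hQ).1, (hS Q hQ).2.1⟩)
    (by
      intro P hP
      obtain ⟨Q, hQ, rfl⟩ := Finset.mem_image.1 hP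
      have := shell_close N e (δ * N ^ (e + 1)) Q.1 Q.2 N hN0 (by positivity) (by positivity) hN0
        (shellF_ge_N N e Q.1 hN0 (by positivity)) (hS Q hQ).2.2
      rw [mul_div_cancel_right₀ _ (by positivity)] at this
      simpa using this)
    (by rw [h87]; exact flat_inc N e X hN0 hX0 hXN)
    (by
      rw [h87]
      intro x y U h1 h2 h3 h4
      exact (shell_sec N e X N hN0 hX0 le_rfl hXN x y U h1 h2 h3 h4).trans (le_abs_self _))
  rw [hcard] at hblk
  refine hblk.trans ?_
  have eB : 8 * X / N = 8 * t := by rw [hX]; field_simp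
  have eb : X / (9 * N) = t / 9 := by rw [hX]; field_simp
  rw [eB, eb]
  have hlam : (t / 9) ^ e * (N ^ (e + 2) / (9 * N) ^ (e + 3)) = t ^ e / (9 ^ (2 * e + 3) * N) := by
    rw [div_pow, mul_pow]
    field_simp
    ring
  rw [hlam]
  have hL0 : (0 : ℝ) < L := by linarith
  have htp : t ^ (e + 1) ≤ t := pow_le_of_le_one ht0.le ht1 (by omega)
  have t1 : 7 * X / L ≤ 14 * (n ^ 2 * t) := by
    rw [div_le_iff₀ hL0]
    calc 7 * X = 14 * (n ^ 2 * t) * (n / 2) := by rw [hX, hN]; ring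
      _ ≤ _ := by gcongr
  have t2 : (2 : ℝ) ≤ 16 * (n ^ 2 * t) := by linarith
  have t3 : 2 * (8 * t) ^ (e + 1) * (4 * δ / (t ^ e / (9 ^ (2 * e + 3) * N))) =
      8 * 8 ^ (e + 1) * 9 ^ (2 * e + 3) * (N * δ * t) := by
    rw [mul_pow]
    field_simp
    ring
  have t4 : 4 * (8 * t) ^ (e + 1) * (L : ℝ) ^ 2 ≤ 4 * 8 ^ (e + 1) * (n ^ 2 * t) := by
    rw [mul_pow]
    calc 4 * (8 ^ (e + 1) * t ^ (e + 1)) * (L : ℝ) ^ 2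
        ≤ 4 * (8 ^ (e + 1) * t) * n ^ 2 := by gcongr
      _ = _ := by ring
  have t5 : 2 * (8 * t) ^ (e + 1) * (7 * X) * (2 * δ / (t / 9) ^ (e + 1)) =
      28 * 72 ^ (e + 1) * (N * δ * t) := by
    have : (72 : ℝ) ^ (e + 1) = 8 ^ (e + 1) * 9 ^ (e + 1) := by rw [← mul_pow]; norm_num
    rw [mul_pow, div_pow, this, hX]
    field_simp
    ring
  have t6 : 2 * δ / (t / 9) ^ (e + 1) ≤ 2 * 9 ^ (e + 1) * 8 ^ (e + 2) * (N * δ * t) := by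
    rw [div_pow, div_le_iff₀ (by positivity)]
    calc 2 * δ = 2 * δ * 1 := by ring
      _ ≤ 2 * δ * (8 ^ (e + 2) * N * t ^ (e + 2)) := by gcongr
      _ = _ := by field_simp; ring
  have a0 : 0 ≤ n ^ 2 * t := by positivity
  have b0 : 0 ≤ N * δ * t := by positivity
  generalize hA : n ^ 2 * t = A at *
  generalize hG : N * δ * t = G at *
  have c1 : (0 : ℝ) ≤ 8 * 8 ^ (e + 1) * 9 ^ (2 * e + 3) := by positivity
  have c2 : (0 : ℝ) ≤ 4 * 8 ^ (e + 1) := by positivity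
  have c3 : (0 : ℝ) ≤ 28 * 72 ^ (e + 1) := by positivity
  have c4 : (0 : ℝ) ≤ 2 * 9 ^ (e + 1) * 8 ^ (e + 2) := by positivity
  generalize (8 : ℝ) * 8 ^ (e + 1) * 9 ^ (2 * e + 3) = k1 at *
  generalize (4 : ℝ) * 8 ^ (e + 1) = k2 at *
  generalize (28 : ℝ) * 72 ^ (e + 1) = k3 at *
  generalize (2 : ℝ) * 9 ^ (e + 1) * 8 ^ (e + 2) = k4 at *
  have : (14 + 16 + k1 + k2 + k3 + k4) * (n ^ 2 + N * δ) * t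
      = (14 + 16 + k1 + k2 + k3 + k4) * (A + G) := by rw [← hA, ← hG]; ring
  rw [this, add_mul, one_mul, t3, t5]
  have := mul_nonneg c1 a0
  have := mul_nonneg c3 a0
  have := mul_nonneg c4 a0
  have := mul_nonneg c2 b0
  linarith

lemma cusp_block_small (e : ℕ) (he : 1 ≤ e) : ∃ C : ℝ, 0 < C ∧
    ∀ (n δ T : ℝ) (S : Finset (ℕ × ℕ)),
    1 ≤ n → 0 ≤ δ → 1 ≤ T → T ^ 6 ≤ 2 * n ^ 3 → δ / (T ^ 3) ^ (e + 1) ≤ 1 / 4 →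
    (∀ P ∈ S, T ^ 3 * n ^ 3 ≤ (P.1 : ℝ) ∧ (P.1 : ℝ) ≤ 8 * (T ^ 3 * n ^ 3) ∧
      |(P.2 : ℝ) ^ (e + 2) - (P.1 : ℝ) ^ (e + 2) - (n ^ 3) ^ (e + 2)| < δ * (n ^ 3) ^ (e + 1)) →
    (S.card : ℝ) ≤ C * (n ^ 2 + n ^ 3 * δ) * T⁻¹ := by
  refine ⟨14 + 4 + 8 * 9 ^ (2 * e + 3) + 4 + 28 * (e + 2) * 9 ^ (e + 2)
    + 4 * (e + 2) * 9 ^ (e + 2), by positivity, ?_⟩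
  intro n δ T S hn hδ0 hT hTn hδ hS
  have hn0 : 0 < n := by linarith
  have hT0 : 0 < T := by linarith
  set N := n ^ 3 with hN
  have hN0 : 0 < N := by positivity
  set X := T ^ 3 * N with hX
  have hX0 : 0 < X := by positivity
  have hT3 : 1 ≤ T ^ 3 := one_le_pow₀ hT
  have hXN : N ≤ X := by rw [hX]; nlinarith
  have hT4 : 1 ≤ T ^ 4 := one_le_pow₀ hT
  obtain ⟨hL1, hLle, hLge⟩ := floor_half (n * T ^ 4) (by nlinarith)
  set L := ⌊n * T ^ 4⌋₊
  have hcard : (S.image (fun P : ℕ × ℕ => (P.1, (P.1 : ℤ) - (P.2 : ℤ)))).card = S.card := by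
    apply Finset.card_image_of_injective
    rintro ⟨a, b⟩ ⟨c, d⟩ h
    simp only [Prod.mk.injEq] at h ⊢
    omega
  have h87 : X + 7 * X = 8 * X := by ring
  have hblk := block_count (S.image (fun P : ℕ × ℕ => (P.1, (P.1 : ℤ) - (P.2 : ℤ))))
    (fun x => x - shellF N e x) L hL1
    X (7 * X) ((N / (9 * X)) ^ (e + 2) / (e + 2)) ((N / X) ^ (e + 2))
    ((X / (9 * X)) ^ e * (N ^ (e + 2) / (9 * X) ^ (e + 3))) (δ / (T ^ 3) ^ (e + 1))
    (by positivity) (by positivity)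
    (by positivity) (by positivity) (by positivity) hδ
    (by
      intro P hP
      obtain ⟨Q, hQ, rfl⟩ := Finset.mem_image.1 hP
      rw [h87]
      exact ⟨(hS Q hQ).1, (hS Q hQ).2.1⟩)
    (by
      intro P hP
      obtain ⟨Q, hQ, rfl⟩ := Finset.mem_image.1 hP
      have := shell_close N e (δ * N ^ (e + 1)) Q.1 Q.2 X hN0 (by positivity) (by positivity) hX0
        ((hS Q hQ).1.trans (shellF_ge_x N e Q.1 hN0 (by positivity))) (hS Q hQ).2.2
      rw [hX, mul_pow, mul_div_mul_right _ _ (by positivity)] at this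
      rw [abs_sub_comm] at this
      convert this using 2
      push_cast
      ring)
    (by rw [h87]; exact cusp_inc N e X hN0 hXN)
    (by
      rw [h87]
      intro x y U h1 h2 h3 h4
      refine (shell_sec N e X X hN0 hX0 hXN le_rfl x y U h1 h2 h3 h4).trans ?_
      rw [← abs_neg]
      refine le_trans (le_of_eq ?_) (le_abs_self _)
      ring)
  rw [hcard] at hblk
  refine hblk.trans ?_
  have eB : N / X = 1 / T ^ 3 := by rw [hX]; field_simp
  have eb : N / (9 * X) = 1 / (9 * T ^ 3) := by rw [hX]; field_simp
  rw [eB, eb]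
  have hlam : (X / (9 * X)) ^ e * (N ^ (e + 2) / (9 * X) ^ (e + 3)) =
      1 / (9 ^ (2 * e + 3) * N * (T ^ 3) ^ (e + 3)) := by
    have : X / (9 * X) = 1 / 9 := by field_simp
    rw [this, hX, div_pow, mul_pow, mul_pow]
    field_simp
    ring
  rw [hlam]
  have hL0 : (0 : ℝ) < L := by exact_mod_cast hL1
  have hTe : T ≤ (T ^ 3) ^ e := by
    rw [← pow_mul]
    exact le_self_pow₀ hT (by omega)
  have hTe2 : T ^ 9 ≤ (T ^ 3) ^ (e + 2) := by
    rw [← pow_mul]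
    exact pow_le_pow_right₀ hT (by omega)
  have hinv : ((T ^ 3) ^ e)⁻¹ ≤ T⁻¹ := by gcongr
  have t1 : 7 * X / L ≤ 14 * (n ^ 2 * T⁻¹) := by
    rw [div_le_iff₀ hL0]
    calc 7 * X = 14 * (n ^ 2 * T⁻¹) * (n * T ^ 4 / 2) := by rw [hX, hN]; field_simp; norm_num
      _ ≤ _ := by gcongr
  have hT2n : T ≤ 2 * n ^ 2 := by
    apply le_of_pow_le_pow_left₀ (n := 6) (by norm_num) (by positivity)
    have : n ^ 3 ≤ n ^ 12 := pow_le_pow_right₀ hn (by norm_num)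
    calc T ^ 6 ≤ 2 * n ^ 3 := hTn
      _ ≤ 64 * n ^ 12 := by nlinarith [show 0 ≤ n ^ 3 by positivity]
      _ = _ := by ring
  have t2 : (2 : ℝ) ≤ 4 * (n ^ 2 * T⁻¹) := by
    rw [← div_eq_mul_inv, ← mul_div_assoc, le_div_iff₀ hT0]
    linarith
  have hTN : T ^ 3 * T ≤ 2 * N := by
    calc T ^ 3 * T = T ^ 4 := by ring
      _ ≤ T ^ 6 := pow_le_pow_right₀ hT (by norm_num)
      _ ≤ _ := hTn
  have t3 : 2 * (1 / T ^ 3) ^ (e + 2) * (4 * (δ / (T ^ 3) ^ (e + 1)) /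
      (1 / (9 ^ (2 * e + 3) * N * (T ^ 3) ^ (e + 3)))) ≤ 8 * 9 ^ (2 * e + 3) * (N * δ * T⁻¹) := by
    calc _ = 8 * 9 ^ (2 * e + 3) * (N * δ * ((T ^ 3) ^ e)⁻¹) := by
          rw [one_div_pow]
          generalize T ^ 3 = τ at *
          have : 0 < τ := by linarith
          field_simp
          ring
      _ ≤ _ := by gcongr
  have t4 : 4 * (1 / T ^ 3) ^ (e + 2) * (L : ℝ) ^ 2 ≤ 4 * (n ^ 2 * T⁻¹) := by
    rw [one_div_pow]
    calc 4 * (1 / (T ^ 3) ^ (e + 2)) * (L : ℝ) ^ 2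
        ≤ 4 * (1 / T ^ 9) * (n * T ^ 4) ^ 2 := by gcongr
      _ = _ := by field_simp
  have t5 : 2 * (1 / T ^ 3) ^ (e + 2) * (7 * X) * (2 * (δ / (T ^ 3) ^ (e + 1)) /
      ((1 / (9 * T ^ 3)) ^ (e + 2) / (e + 2))) ≤ 28 * (e + 2) * 9 ^ (e + 2) * (N * δ * T⁻¹) := by
    calc _ = 28 * (e + 2) * 9 ^ (e + 2) * (N * δ * ((T ^ 3) ^ e)⁻¹) := by
          rw [one_div_pow, one_div_pow, mul_pow, hX]
          generalize T ^ 3 = τ at *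
          have : 0 < τ := by linarith
          field_simp
          ring
      _ ≤ _ := by gcongr
  have t6 : 2 * (δ / (T ^ 3) ^ (e + 1)) / ((1 / (9 * T ^ 3)) ^ (e + 2) / (e + 2)) ≤
      4 * (e + 2) * 9 ^ (e + 2) * (N * δ * T⁻¹) := by
    calc _ = 2 * (e + 2) * 9 ^ (e + 2) * (δ * T ^ 3) := by
          rw [one_div_pow, mul_pow]
          generalize T ^ 3 = τ at *
          have : 0 < τ := by linarith
          field_simp
          ring
      _ ≤ 2 * (e + 2) * 9 ^ (e + 2) * (δ * (2 * N * T⁻¹)) := by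
          gcongr
          rw [← div_eq_mul_inv, le_div_iff₀ hT0]
          exact hTN
      _ = _ := by ring
  have a0 : 0 ≤ n ^ 2 * T⁻¹ := by positivity
  have b0 : 0 ≤ N * δ * T⁻¹ := by positivity
  have c1 : (0 : ℝ) ≤ 8 * 9 ^ (2 * e + 3) := by positivity
  have c3 : (0 : ℝ) ≤ 28 * (e + 2) * 9 ^ (e + 2) := by positivity
  have c4 : (0 : ℝ) ≤ 4 * (e + 2) * 9 ^ (e + 2) := by positivity
  have hfin : ∀ k : ℝ, k * (n ^ 2 + N * δ) * T⁻¹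
      = k * (n ^ 2 * T⁻¹ + N * δ * T⁻¹) := by intro k; ring
  rw [hfin, add_mul (2 * (1 / T ^ 3) ^ (e + 2) * (7 * X)), one_mul]
  have := mul_nonneg c1 a0
  have := mul_nonneg c3 a0
  have := mul_nonneg c4 a0
  linarith

lemma by_columns (S : Finset (ℕ × ℕ)) (h : ℝ → ℝ) (Z δ : ℝ) (hZ : 0 ≤ Z) (hδ : 0 ≤ δ)
    (hS : ∀ P ∈ S, 0 < P.1 ∧ (P.1 : ℝ) ≤ Z ∧ |(P.2 : ℝ) - h P.1| ≤ δ) :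
    (S.card : ℝ) ≤ Z * (2 * δ + 1) := by
  classical
  have h1 : ∀ P ∈ S, P.1 ∈ Finset.Icc 1 ⌊Z⌋₊ := by
    intro P hP
    rw [Finset.mem_Icc]
    exact ⟨(hS P hP).1, Nat.le_floor (hS P hP).2.1⟩
  rw [Finset.card_eq_sum_card_fiberwise h1]
  push_cast
  calc ∑ j ∈ Finset.Icc 1 ⌊Z⌋₊, ((S.filter (fun P => P.1 = j)).card : ℝ)
      ≤ ∑ j ∈ Finset.Icc 1 ⌊Z⌋₊, (2 * δ + 1) := by
        apply Finset.sum_le_sum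
        intro j _
        apply spread_card _ (fun P => (P.2 : ℤ)) (2 * δ) (by positivity)
        · intro P hP Q hQ hPQ
          have h1 := (Finset.mem_filter.1 hP).2
          have h2 := (Finset.mem_filter.1 hQ).2
          exact Prod.ext (h1.trans h2.symm) (by exact_mod_cast hPQ)
        · intro P hP Q hQ
          obtain ⟨hP1, hP2⟩ := Finset.mem_filter.1 hP
          obtain ⟨hQ1, hQ2⟩ := Finset.mem_filter.1 hQ
          have h1 := abs_le.1 (hS P hP1).2.2
          have h2 := abs_le.1 (hS Q hQ1).2.2
          rw [hP2] at h1
          rw [hQ2] at h2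
          simp only [Int.cast_natCast]
          linarith [h1.1, h2.2]
    _ = (⌊Z⌋₊ : ℝ) * (2 * δ + 1) := by
        rw [Finset.sum_const, Nat.card_Icc, nsmul_eq_mul, Nat.add_sub_cancel]
    _ ≤ _ := by
        apply mul_le_mul_of_nonneg_right (Nat.floor_le hZ) (by positivity)

lemma cusp_block (e : ℕ) (he : 1 ≤ e) : ∃ C : ℝ, 0 < C ∧
    ∀ (n δ T : ℝ) (S : Finset (ℕ × ℕ)),
    1 ≤ n → 0 ≤ δ → 1 ≤ T → T ^ 6 ≤ 2 * n ^ 3 →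
    (∀ P ∈ S, T ^ 3 * n ^ 3 ≤ (P.1 : ℝ) ∧ (P.1 : ℝ) ≤ 8 * (T ^ 3 * n ^ 3) ∧
      |(P.2 : ℝ) ^ (e + 2) - (P.1 : ℝ) ^ (e + 2) - (n ^ 3) ^ (e + 2)| < δ * (n ^ 3) ^ (e + 1)) →
    (S.card : ℝ) ≤ C * (n ^ 2 + n ^ 3 * δ) * T⁻¹ := by
  obtain ⟨C, hC, h⟩ := cusp_block_small e he
  refine ⟨C + 48, by positivity, ?_⟩
  intro n δ T S hn hδ0 hT hTn hS
  have hn0 : 0 < n := by linarith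
  have hT0 : 0 < T := by linarith
  have hN0 : 0 < n ^ 3 := by positivity
  have hA : 0 ≤ (n ^ 2 + n ^ 3 * δ) * T⁻¹ := by positivity
  by_cases hδ : δ / (T ^ 3) ^ (e + 1) ≤ 1 / 4
  · have := h n δ T S hn hδ0 hT hTn hδ hS
    nlinarith
  · push Not at hδ
    have hX0 : 0 < T ^ 3 * n ^ 3 := by positivity
    have h1 := by_columns S (shellF (n ^ 3) e) (8 * (T ^ 3 * n ^ 3)) (δ / (T ^ 3) ^ (e + 1))
      (by positivity) (by positivity) (by
        intro Q hQ
        refine ⟨?_, (hS Q hQ).2.1, ?_⟩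
        · have := hX0.trans_le (hS Q hQ).1
          exact_mod_cast this
        · have := shell_close (n ^ 3) e (δ * (n ^ 3) ^ (e + 1)) Q.1 Q.2 (T ^ 3 * n ^ 3) hN0
            (by positivity) (by positivity) hX0
            ((hS Q hQ).1.trans (shellF_ge_x _ e Q.1 hN0 (by positivity))) (hS Q hQ).2.2
          rwa [mul_pow, mul_div_mul_right _ _ (by positivity)] at this)
    have hTe : T ≤ (T ^ 3) ^ e := by
      rw [← pow_mul]
      exact le_self_pow₀ hT (by omega)
    have hinv : ((T ^ 3) ^ e)⁻¹ ≤ T⁻¹ := by gcongr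
    have h2 : (S.card : ℝ) ≤ 48 * (n ^ 3 * δ * T⁻¹) := by
      calc (S.card : ℝ) ≤ 8 * (T ^ 3 * n ^ 3) * (2 * (δ / (T ^ 3) ^ (e + 1)) + 1) := h1
        _ ≤ 8 * (T ^ 3 * n ^ 3) * (6 * (δ / (T ^ 3) ^ (e + 1))) := by
            gcongr
            linarith
        _ = 48 * (n ^ 3 * δ * ((T ^ 3) ^ e)⁻¹) := by field_simp; ring
        _ ≤ _ := by gcongr
    have h3 : 0 ≤ C * (n ^ 2 + n ^ 3 * δ) * T⁻¹ := by positivity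
    have h4 : 0 ≤ n ^ 2 * T⁻¹ := by positivity
    nlinarith

lemma geom_fibers {α : Type*} (S : Finset α) (idx : α → ℕ) (A r : ℝ) (hA : 0 ≤ A) (hr0 : 0 ≤ r)
    (hr : r ≤ 1 / 2) (h : ∀ i, (((S.filter (fun P => idx P = i)).card : ℕ) : ℝ) ≤ A * r ^ i) :
    (S.card : ℝ) ≤ 2 * A := by
  classical
  rw [Finset.card_eq_sum_card_image idx S]
  push_cast
  have hr1 : r < 1 := by linarith
  have hsum := summable_geometric_of_lt_one hr0 hr1
  calc ∑ i ∈ S.image idx, ((S.filter (fun P => idx P = i)).card : ℝ)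
      ≤ ∑ i ∈ S.image idx, A * r ^ i := Finset.sum_le_sum (fun i _ => h i)
    _ = A * ∑ i ∈ S.image idx, r ^ i := by rw [Finset.mul_sum]
    _ ≤ A * ∑' i, r ^ i := by
        gcongr
        exact hsum.sum_le_tsum _ (fun i _ => by positivity)
    _ = A * (1 - r)⁻¹ := by rw [tsum_geometric_of_lt_one hr0 hr1]
    _ ≤ A * 2 := by
        gcongr
        rw [inv_le_comm₀ (by linarith) (by norm_num)]
        linarith
    _ = _ := by ring

lemma shell_finset_bound (e : ℕ) (he : 1 ≤ e) : ∃ C : ℝ, 0 < C ∧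
    ∀ (n δ J : ℝ) (S : Finset (ℕ × ℕ)), 1 ≤ n → 0 ≤ δ → 0 < J →
    J ^ (e + 2) = (n ^ 3) ^ (e + 1) → δ * (n ^ 3) ^ (e + 1) ≤ (n ^ 3) ^ (e + 2) →
    (∀ P ∈ S, 0 < P.1 ∧ P.1 < P.2 ∧
      |(P.2 : ℝ) ^ (e + 2) - (P.1 : ℝ) ^ (e + 2) - (n ^ 3) ^ (e + 2)| < δ * (n ^ 3) ^ (e + 1)) →
    (S.card : ℝ) ≤ C * (J + n ^ 3 * δ) := by
  classical
  obtain ⟨C1, hC1, hcusp⟩ := cusp_block e he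
  obtain ⟨C2, hC2, hflat⟩ := flat_block e he
  refine ⟨2 * C1 + 2 * C2 + 8, by positivity, ?_⟩
  intro n δ J S hn hδ0 hJ0 hJ hDR hS
  have hn0 : 0 < n := by linarith
  have hN0 : 0 < n ^ 3 := by positivity
  have hN1 : 1 ≤ n ^ 3 := one_le_pow₀ hn
  have hnJ : n ^ 2 ≤ J := by
    apply le_of_pow_le_pow_left₀ (n := e + 2) (by omega) hJ0.le
    rw [hJ, ← pow_mul, ← pow_mul]
    exact pow_le_pow_right₀ hn (by omega)
  have hclose : ∀ P ∈ S, |(P.2 : ℝ) - shellF (n ^ 3) e P.1| ≤ δ := by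
    intro Q hQ
    have := shell_close (n ^ 3) e (δ * (n ^ 3) ^ (e + 1)) Q.1 Q.2 (n ^ 3) hN0 (by positivity)
      (by positivity) hN0 (shellF_ge_N _ e Q.1 hN0 (by positivity)) (hS Q hQ).2.2
    rwa [mul_div_cancel_right₀ _ (by positivity)] at this
  set A := n ^ 2 + n ^ 3 * δ with hA
  have hA0 : 0 ≤ A := by positivity
  have hAJ : A ≤ J + n ^ 3 * δ := by linarith
  -- cusp part
  have hS1 : ((S.filter (fun P => n ^ 3 ≤ (P.1 : ℝ))).card : ℝ) ≤ 2 * (C1 * A) := by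
    have hidx : ∀ P : ℕ × ℕ, ∃ i : ℕ, n ^ 3 ≤ (P.1 : ℝ) →
        (8 : ℝ) ^ i ≤ P.1 / n ^ 3 ∧ P.1 / n ^ 3 < (8 : ℝ) ^ (i + 1) := by
      intro P
      by_cases h : n ^ 3 ≤ (P.1 : ℝ)
      · obtain ⟨i, hi⟩ := exists_nat_pow_near (x := (P.1 : ℝ) / n ^ 3) (y := 8)
          (by rw [le_div_iff₀ hN0]; linarith) (by norm_num)
        exact ⟨i, fun _ => hi⟩
      · exact ⟨0, fun h' => absurd h' h⟩
    choose idx hidx using hidx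
    apply geom_fibers _ idx (C1 * A) (1 / 2) (by positivity) (by norm_num) (by norm_num)
    intro i
    set Fi := (S.filter (fun P => n ^ 3 ≤ (P.1 : ℝ))).filter (fun P => idx P = i) with hFi
    rcases Fi.eq_empty_or_nonempty with h0 | ⟨P0, hP0⟩
    · rw [h0]; simp; positivity
    have h8 : ((2 : ℝ) ^ i) ^ 3 = 8 ^ i := by rw [← pow_mul, mul_comm, pow_mul]; norm_num
    have hinfo : ∀ P ∈ Fi, P ∈ S ∧ ((2 : ℝ) ^ i) ^ 3 * n ^ 3 ≤ (P.1 : ℝ) ∧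
        (P.1 : ℝ) ≤ 8 * (((2 : ℝ) ^ i) ^ 3 * n ^ 3) := by
      intro P hP
      obtain ⟨hP1, hP2⟩ := Finset.mem_filter.1 hP
      obtain ⟨hP3, hP4⟩ := Finset.mem_filter.1 hP1
      obtain ⟨h1, h2⟩ := hidx P hP4
      rw [hP2] at h1 h2
      rw [le_div_iff₀ hN0] at h1
      rw [div_lt_iff₀ hN0, pow_succ] at h2
      rw [h8]
      exact ⟨hP3, h1, by linarith⟩
    have := hcusp n δ (2 ^ i) Fi hn hδ0 (one_le_pow₀ (by norm_num)) (by
        obtain ⟨hPS, hP1, _⟩ := hinfo P0 hP0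
        obtain ⟨hp0, hpk, hab⟩ := hS P0 hPS
        have h1 : (P0.1 : ℝ) + 1 ≤ P0.2 := by exact_mod_cast hpk
        have hj0 : (0 : ℝ) ≤ P0.1 := by positivity
        have h2 : (P0.1 : ℝ) ^ (e + 1) ≤ (P0.2 : ℝ) ^ (e + 2) - (P0.1 : ℝ) ^ (e + 2) := by
          have h3 : (P0.1 : ℝ) ^ (e + 1) ≤ (P0.2 : ℝ) ^ (e + 1) := by gcongr
          have h4 : ((P0.1 : ℝ) + 1) * (P0.1 : ℝ) ^ (e + 1) ≤ P0.2 * (P0.2 : ℝ) ^ (e + 1) := by gcongr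
          have e1 : (P0.2 : ℝ) ^ (e + 2) = P0.2 * (P0.2 : ℝ) ^ (e + 1) := by ring
          have e2 : (P0.1 : ℝ) ^ (e + 2) = P0.1 * (P0.1 : ℝ) ^ (e + 1) := by ring
          rw [e1, e2]
          linarith
        have h3 := (abs_lt.1 hab).2
        have h4 : (((2 : ℝ) ^ i) ^ 3 * n ^ 3) ^ (e + 1) ≤ (P0.1 : ℝ) ^ (e + 1) := by gcongr
        have h5 : (((2 : ℝ) ^ i) ^ 3) ^ (e + 1) * (n ^ 3) ^ (e + 1) ≤ 2 * n ^ 3 * (n ^ 3) ^ (e + 1) := by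
          rw [← mul_pow]
          have e1 : (n ^ 3) ^ (e + 2) = n ^ 3 * (n ^ 3) ^ (e + 1) := by ring
          rw [e1] at h3 hDR
          linarith
        have h6 := le_of_mul_le_mul_right h5 (by positivity)
        have hT : (1 : ℝ) ≤ 2 ^ i := one_le_pow₀ (by norm_num)
        refine le_trans ?_ h6
        rw [← pow_mul ((2:ℝ) ^ i) 3 (e + 1)]
        exact pow_le_pow_right₀ hT (by omega))
      (fun P hP => ⟨(hinfo P hP).2.1, (hinfo P hP).2.2, (hS P (hinfo P hP).1).2.2⟩)
    rw [one_div, inv_pow]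
    exact this
  -- flat part
  have hS2 : ((S.filter (fun P => ¬ n ^ 3 ≤ (P.1 : ℝ))).card : ℝ) ≤
      8 * (J + n ^ 3 * δ) + 2 * (C2 * A) := by
    set S2 := S.filter (fun P => ¬ n ^ 3 ≤ (P.1 : ℝ)) with hS2def
    have hS2m : ∀ P ∈ S2, P ∈ S ∧ (P.1 : ℝ) < n ^ 3 := by
      intro P hP
      obtain ⟨h1, h2⟩ := Finset.mem_filter.1 hP
      exact ⟨h1, not_le.1 h2⟩
    have hCA : 0 ≤ C2 * A := by positivity
    have hNδ : 0 ≤ n ^ 3 * δ := by positivity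
    by_cases hδ : δ ≤ 1 / 4
    · have hsplit : (S2.filter (fun P => (P.1 : ℝ) < J)).card +
          (S2.filter (fun P => ¬ (P.1 : ℝ) < J)).card = S2.card :=
        Finset.card_filter_add_card_filter_not _
      have hsplit' : (S2.card : ℝ) = (S2.filter (fun P => (P.1 : ℝ) < J)).card +
          (S2.filter (fun P => ¬ (P.1 : ℝ) < J)).card := by exact_mod_cast hsplit.symm
      have ha : ((S2.filter (fun P => (P.1 : ℝ) < J)).card : ℝ) ≤ J * (2 * δ + 1) := by
        apply by_columns _ (shellF (n ^ 3) e) J δ hJ0.le hδ0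
        intro P hP
        obtain ⟨h1, h2⟩ := Finset.mem_filter.1 hP
        have h3 := (hS2m P h1).1
        exact ⟨(hS P h3).1, h2.le, hclose P h3⟩
      have hb : ((S2.filter (fun P => ¬ (P.1 : ℝ) < J)).card : ℝ) ≤ 2 * (C2 * A) := by
        have hidx : ∀ P : ℕ × ℕ, ∃ i : ℕ, (0 < (P.1 : ℝ) ∧ (P.1 : ℝ) < n ^ 3) →
            (8 : ℝ) ^ i ≤ n ^ 3 / P.1 ∧ n ^ 3 / P.1 < (8 : ℝ) ^ (i + 1) := by
          intro P
          by_cases h : 0 < (P.1 : ℝ) ∧ (P.1 : ℝ) < n ^ 3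
          · obtain ⟨i, hi⟩ := exists_nat_pow_near (x := n ^ 3 / (P.1 : ℝ)) (y := 8)
              (by rw [le_div_iff₀ h.1]; linarith [h.2]) (by norm_num)
            exact ⟨i, fun _ => hi⟩
          · exact ⟨0, fun h' => absurd h' h⟩
        choose idx hidx using hidx
        apply geom_fibers _ idx (C2 * A) (1 / 8) (by positivity) (by norm_num) (by norm_num)
        intro i
        set Fi := (S2.filter (fun P => ¬ (P.1 : ℝ) < J)).filter (fun P => idx P = i) with hFi
        rcases Fi.eq_empty_or_nonempty with h0 | ⟨P0, hP0⟩
        · rw [h0]; simp; positivity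
        set t : ℝ := (1 / 8) ^ (i + 1) with ht
        have ht8 : t * 8 ^ (i + 1) = 1 := by rw [ht, ← mul_pow]; norm_num
        have ht0 : 0 < t := by positivity
        have ht1 : t ≤ 1 := pow_le_one₀ (by norm_num) (by norm_num)
        have hinfo : ∀ P ∈ Fi, P ∈ S ∧ J ≤ (P.1 : ℝ) ∧ t * n ^ 3 ≤ (P.1 : ℝ) ∧
            (P.1 : ℝ) ≤ 8 * (t * n ^ 3) := by
          intro P hP
          obtain ⟨hP1, hP2⟩ := Finset.mem_filter.1 hP
          obtain ⟨hP3, hP4⟩ := Finset.mem_filter.1 hP1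
          obtain ⟨hPS, hPN⟩ := hS2m P hP3
          have hp0 : (0 : ℝ) < P.1 := by exact_mod_cast (hS P hPS).1
          obtain ⟨h1, h2⟩ := hidx P ⟨hp0, hPN⟩
          rw [hP2] at h1 h2
          rw [le_div_iff₀ hp0] at h1
          rw [div_lt_iff₀ hp0] at h2
          refine ⟨hPS, not_lt.1 hP4, ?_, ?_⟩
          · calc t * n ^ 3 ≤ t * (8 ^ (i + 1) * P.1) := by gcongr
              _ = (t * 8 ^ (i + 1)) * P.1 := by ring
              _ = P.1 := by rw [ht8, one_mul]
          · calc (P.1 : ℝ) = (t * 8 ^ (i + 1)) * P.1 := by rw [ht8, one_mul]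
              _ = 8 * (t * (8 ^ i * P.1)) := by ring
              _ ≤ _ := by gcongr
        obtain ⟨_, hJP, _, hP8⟩ := hinfo P0 hP0
        have hJ8 : J ≤ 8 * (t * n ^ 3) := hJP.trans hP8
        have := hflat n δ t Fi hn hδ0 hδ ht0 ht1 (by
            have h1 : n ^ 2 * 1 ≤ n ^ 2 * (8 * (t * n)) := by
              calc n ^ 2 * 1 ≤ J := by linarith
                _ ≤ 8 * (t * n ^ 3) := hJ8
                _ = _ := by ring
            have h2 := le_of_mul_le_mul_left h1 (by positivity)
            have h3 : t * n ≤ t * n ^ 2 := by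
              gcongr
              exact le_self_pow₀ hn (by norm_num)
            linarith)
          (by
            have h1 : J ^ (e + 2) ≤ (8 * (t * n ^ 3)) ^ (e + 2) := by gcongr
            rw [hJ] at h1
            have h2 : (n ^ 3) ^ (e + 1) * 1 ≤
                (n ^ 3) ^ (e + 1) * (8 ^ (e + 2) * n ^ 3 * t ^ (e + 2)) := by
              calc (n ^ 3) ^ (e + 1) * 1 ≤ (8 * (t * n ^ 3)) ^ (e + 2) := by linarith
                _ = _ := by rw [mul_pow, mul_pow]; ring
            exact le_of_mul_le_mul_left h2 (by positivity))
          (fun P hP => ⟨(hinfo P hP).2.2.1, (hinfo P hP).2.2.2, (hS P (hinfo P hP).1).2.2⟩)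
        refine this.trans ?_
        apply mul_le_mul_of_nonneg_left _ hCA
        exact pow_le_pow_of_le_one (by norm_num) (by norm_num) (by omega)
      have : J * (2 * δ + 1) ≤ 8 * J := by nlinarith
      linarith
    · push Not at hδ
      have h1 : (S2.card : ℝ) ≤ n ^ 3 * (2 * δ + 1) := by
        apply by_columns _ (shellF (n ^ 3) e) (n ^ 3) δ hN0.le hδ0
        intro P hP
        obtain ⟨h1, h2⟩ := hS2m P hP
        exact ⟨(hS P h1).1, h2.le, hclose P h1⟩
      have : n ^ 3 * (2 * δ + 1) ≤ 6 * (n ^ 3 * δ) := by nlinarith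
      linarith
  have hsplit : (S.filter (fun P => n ^ 3 ≤ (P.1 : ℝ))).card +
      (S.filter (fun P => ¬ n ^ 3 ≤ (P.1 : ℝ))).card = S.card :=
    Finset.card_filter_add_card_filter_not _
  have hsplit' : (S.card : ℝ) = (S.filter (fun P => n ^ 3 ≤ (P.1 : ℝ))).card +
      (S.filter (fun P => ¬ n ^ 3 ≤ (P.1 : ℝ))).card := by exact_mod_cast hsplit.symm
  have h1 : C1 * A ≤ C1 * (J + n ^ 3 * δ) := by gcongr
  have h2 : C2 * A ≤ C2 * (J + n ^ 3 * δ) := by gcongr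
  rw [hsplit']
  linarith

lemma shell_set_bound (d : ℕ) (hd : 3 ≤ d) : ∃ C : ℝ, 0 < C ∧ ∀ D s : ℝ, 1 ≤ D → 1 < s →
    (({p : ℕ × ℕ | 0 < p.1 ∧ p.1 < p.2 ∧
        |(p.2 : ℝ) ^ d - (p.1 : ℝ) ^ d - D ^ s| < D}).ncard : ℝ)
      ≤ C * (D ^ ((s / d) * (1 - 1 / d)) + D ^ (1 + s * (2 / d - 1))) := by
  obtain ⟨e, rfl⟩ : ∃ e, d = e + 2 := ⟨d - 2, by omega⟩
  obtain ⟨C, hC, h⟩ := shell_finset_bound e (by omega)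
  refine ⟨C, hC, ?_⟩
  intro D s hD hs
  have hD0 : 0 < D := by linarith
  set S := {p : ℕ × ℕ | 0 < p.1 ∧ p.1 < p.2 ∧
        |(p.2 : ℝ) ^ (e + 2) - (p.1 : ℝ) ^ (e + 2) - D ^ s| < D} with hSdef
  by_cases hfin : S.Finite
  swap
  · rw [Set.Infinite.ncard hfin]
    simp only [Nat.cast_zero]
    positivity
  have hd0 : ((e + 2 : ℕ) : ℝ) ≠ 0 := by positivity
  set n : ℝ := D ^ (s / (e + 2 : ℕ) / 3) with hn
  have hn3 : n ^ 3 = D ^ (s / (e + 2 : ℕ)) := by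
    rw [hn, ← Real.rpow_mul_natCast hD0.le]
    congr 1
    push_cast
    field_simp
  have hR : (n ^ 3) ^ (e + 2) = D ^ s := by
    rw [hn3, ← Real.rpow_mul_natCast hD0.le]
    congr 1
    field_simp
  have hQ : (n ^ 3) ^ (e + 1) = D ^ (s / (e + 2 : ℕ) * (e + 1 : ℕ)) := by
    rw [hn3, ← Real.rpow_mul_natCast hD0.le]
  have hn1 : 1 ≤ n := Real.one_le_rpow hD (by positivity)
  have hn0 : 0 < n := by linarith
  set δ := D / (n ^ 3) ^ (e + 1) with hδ
  have hδD : δ * (n ^ 3) ^ (e + 1) = D := by rw [hδ]; field_simp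
  have hJ : (D ^ ((s / (e + 2 : ℕ)) * (1 - 1 / (e + 2 : ℕ)))) ^ (e + 2) = (n ^ 3) ^ (e + 1) := by
    rw [hQ, ← Real.rpow_mul_natCast hD0.le]
    congr 1
    have : ((e + 2 : ℕ) : ℝ) = e + 2 := by push_cast; ring
    rw [mul_assoc, sub_mul, one_div, inv_mul_cancel₀ hd0]
    push_cast
    ring
  have hE : n ^ 3 * δ = D ^ (1 + s * (2 / (e + 2 : ℕ) - 1)) := by
    rw [hδ, hQ, hn3]
    nth_rewrite 2 [← Real.rpow_one D]
    rw [← Real.rpow_sub hD0, ← Real.rpow_add hD0]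
    congr 1
    push_cast
    have : (e : ℝ) + 2 ≠ 0 := by positivity
    field_simp
    ring
  have := h n δ (D ^ ((s / (e + 2 : ℕ)) * (1 - 1 / (e + 2 : ℕ)))) hfin.toFinset hn1
    (by positivity) (by positivity) hJ
    (by
      rw [hδD, hR]
      calc D = D ^ (1 : ℝ) := (Real.rpow_one D).symm
        _ ≤ D ^ s := Real.rpow_le_rpow_of_exponent_le hD hs.le)
    (by
      intro P hP
      rw [Set.Finite.mem_toFinset] at hP
      rw [hR, hδD]
      exact hP)
  rw [Set.ncard_eq_toFinset_card S hfin, ← hE]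
  exact this

theorem lattice_points_in_special_shell (d : ℕ) (hd : 3 ≤ d) :
    ∃ C : ℝ, 0 < C ∧ ∀ D s : ℝ, 1 ≤ D → 1 < s → s ≤ 2 →
      ((s ≤ (d : ℝ) ^ 2 / ((d : ℝ) ^ 2 - d - 1) →
        (({p : ℕ × ℕ | 0 < p.1 ∧ p.1 < p.2 ∧
            |(p.2 : ℝ) ^ d - (p.1 : ℝ) ^ d - D ^ s| < D}).ncard : ℝ)
          ≤ C * D ^ (1 + s * (2 / d - 1))) ∧
      ((d : ℝ) ^ 2 / ((d : ℝ) ^ 2 - d - 1) ≤ s →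
        (({p : ℕ × ℕ | 0 < p.1 ∧ p.1 < p.2 ∧
            |(p.2 : ℝ) ^ d - (p.1 : ℝ) ^ d - D ^ s| < D}).ncard : ℝ)
          ≤ C * D ^ ((s / d) * (1 - 1 / d)))) := by
  obtain ⟨C, hC, h⟩ := shell_set_bound d hd
  refine ⟨2 * C, by positivity, ?_⟩
  intro D s hD hs _
  have hb := h D s hD hs
  have hd3 : (3 : ℝ) ≤ d := by exact_mod_cast hd
  have hd0 : (0 : ℝ) < d := by linarith
  have hq : 0 < (d : ℝ) ^ 2 - d - 1 := by nlinarith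
  have hdiff : 1 + s * (2 / d - 1) - (s / d) * (1 - 1 / d)
      = (d ^ 2 - s * ((d : ℝ) ^ 2 - d - 1)) / d ^ 2 := by
    field_simp
    ring
  constructor
  · intro hle
    rw [le_div_iff₀ hq] at hle
    have h1 : 0 ≤ (d ^ 2 - s * ((d : ℝ) ^ 2 - d - 1)) / (d : ℝ) ^ 2 :=
      div_nonneg (by linarith) (by positivity)
    have h2 : D ^ ((s / d) * (1 - 1 / d)) ≤ D ^ (1 + s * (2 / d - 1)) :=
      Real.rpow_le_rpow_of_exponent_le hD (by linarith)
    nlinarith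
  · intro hle
    rw [div_le_iff₀ hq] at hle
    have h1 : (d ^ 2 - s * ((d : ℝ) ^ 2 - d - 1)) / (d : ℝ) ^ 2 ≤ 0 :=
      div_nonpos_of_nonpos_of_nonneg (by linarith) (by positivity)
    have h2 : D ^ (1 + s * (2 / d - 1)) ≤ D ^ ((s / d) * (1 - 1 / d)) :=
      Real.rpow_le_rpow_of_exponent_le hD (by linarith)
    nlinarith
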